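/- Let n ≥ 1, x_1,...,x_n ∈ ℝ^d, y ∈ {−1,+1}^n, and w ∈ ℝ^d, and write s_k = ⟨w, x_k⟩. Suppose Δ : {−1,+1}^n × {−1,+1}^n → ℝ is a loss that depends on its second argument y' only through the pair of counts (a, b), where a = #{k : y_k = +1 and y'_k = +1} and b = #{k : y_k = −1 and y'_k = +1}. Then there exists a maximizer y' of the objective y' ↦ Δ(y, y') − Σ_{k=1}^{n}(y_k − y'_k)·s_k with the following threshold structure: among the indices k with y_k = +1, the indices assigned y'_k = +1 are exactly a indices with the largest scores s_k (for some 0 ≤ a ≤ #{k : y_k = +1}), and among the indices k with y_k = −1, the indices assigned y'_k = +1 are exactly b indices with the largest scores s_k (for some 0 ≤ b ≤ #{k : y_k = −1}). -/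

import Mathlib

/-- Precomposing with the swap of two indices carrying the same label does not change the
number of selected indices of a given label. -/
theorem card_filter_comp_swap {ι α : Type*} [Fintype ι] [DecidableEq ι] (y : ι → α) (c : α)
    (t : ι → Bool) {i j : ι} (hij : y i = y j)
    [DecidablePred fun k => y k = c ∧ t k = true]
    [DecidablePred fun k => y k = c ∧ t (Equiv.swap i j k) = true] :
    (Finset.univ.filter (fun k => y k = c ∧ t k = true)).card =
      (Finset.univ.filter (fun k => y k = c ∧ t (Equiv.swap i j k) = true)).card := by
  refine Finset.card_equiv (Equiv.swap i j) fun k => ?_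
  have hy : y (Equiv.swap i j k) = y k := by
    rw [Equiv.swap_apply_def]
    split_ifs <;> simp_all
  simp [hy]

/-- Swapping a selected index `i` with an unselected index `j` changes the linear term by
twice the difference of their scores. -/
theorem sum_sub_sign_comp_swap {ι : Type*} [Fintype ι] [DecidableEq ι] (y s : ι → ℝ)
    (t : ι → Bool) {i j : ι} (hi : t i = true) (hj : t j = false) :
    ∑ k, (y k - (if t k then (1 : ℝ) else -1)) * s k -
      ∑ k, (y k - (if t (Equiv.swap i j k) then (1 : ℝ) else -1)) * s k =
        2 * (s j - s i) := by
  have hne : i ≠ j := by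
    rintro rfl
    simp_all
  rw [← Finset.sum_sub_distrib, Fintype.sum_eq_add i j hne]
  · simp only [Equiv.swap_apply_left, Equiv.swap_apply_right, hi, hj]
    simp only [if_true, Bool.false_eq_true, if_false]
    ring
  · rintro k ⟨hki, hkj⟩
    rw [Equiv.swap_apply_of_ne_of_ne hki hkj, sub_self]

open Classical in
/-- Threshold structure of the maximizer in the structured-loss inference
problem.  Candidate label vectors `y' ∈ {−1,+1}^n` are enumerated by `t : Fin n → Bool`
via `y'_k = if t k then 1 else −1`.  If the loss `Δ(y, ·)` depends on `y'` only through
the counts `a = #{k : y_k = 1 ∧ y'_k = 1}` and `b = #{k : y_k = −1 ∧ y'_k = 1}`, then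
there is a maximizer `y'` of `y' ↦ Δ(y, y') − Σ_k (y_k − y'_k)·s_k` such that, among the
positives (`y_k = 1`), the indices assigned `+1` have the largest scores, and likewise
among the negatives (`y_k = −1`). -/
theorem inference_maximizer_threshold_structure (n d : ℕ) (hn : 1 ≤ n)
    (x : Fin n → Fin d → ℝ) (y : Fin n → ℝ)
    (hy : ∀ k, y k = 1 ∨ y k = -1) (w : Fin d → ℝ)
    (s : Fin n → ℝ) (hs : ∀ k, s k = ∑ i, w i * x k i)
    (Δ : (Fin n → ℝ) → (Fin n → ℝ) → ℝ)
    (hΔ : ∀ t₁ t₂ : Fin n → Bool,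
      (Finset.univ.filter (fun k => y k = 1 ∧ t₁ k = true)).card =
        (Finset.univ.filter (fun k => y k = 1 ∧ t₂ k = true)).card →
      (Finset.univ.filter (fun k => y k = -1 ∧ t₁ k = true)).card =
        (Finset.univ.filter (fun k => y k = -1 ∧ t₂ k = true)).card →
      Δ y (fun k => if t₁ k then 1 else -1) = Δ y (fun k => if t₂ k then 1 else -1)) :
    ∃ t : Fin n → Bool,
      (∀ t' : Fin n → Bool,
        Δ y (fun k => if t' k then 1 else -1) -
            (∑ k, (y k - (if t' k then (1 : ℝ) else -1)) * s k) ≤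
          Δ y (fun k => if t k then 1 else -1) -
            (∑ k, (y k - (if t k then (1 : ℝ) else -1)) * s k)) ∧
      (∀ k k', y k = 1 → y k' = 1 → t k = true → t k' = false → s k' ≤ s k) ∧
      (∀ k k', y k = -1 → y k' = -1 → t k = true → t k' = false → s k' ≤ s k) := by
  obtain ⟨t, ht⟩ := Finite.exists_max fun t : Fin n → Bool =>
    Δ y (fun k => if t k then 1 else -1) -
      (∑ k, (y k - (if t k then (1 : ℝ) else -1)) * s k)
  have key : ∀ i j, y i = y j → t i = true → t j = false → s j ≤ s i := by
    intro i j hij hi hj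
    have hmax := ht fun k => t (Equiv.swap i j k)
    have hloss := hΔ t (fun k => t (Equiv.swap i j k))
      (card_filter_comp_swap y 1 t hij) (card_filter_comp_swap y (-1) t hij)
    have hsum := sum_sub_sign_comp_swap y s t hi hj
    linarith
  exact ⟨t, ht, fun i j hi hj => key i j (hi.trans hj.symm),
    fun i j hi hj => key i j (hi.trans hj.symm)⟩
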